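/- arXiv:2501.16669 — 2 statements merged into one kernel-verified Lean document; each statement's English description precedes it below -/
import Mathlib

section
/- Let n ≥ 2, m ≥ 1, and let e_1, e_2, …, e_{n+m} be positive real numbers forming a log-convex sequence, i.e. e_k^2 ≤ e_{k-1}·e_{k+1} for all 2 ≤ k ≤ n+m−1. Let α_1, …, α_{n−1} be nonnegative real numbers, not all zero, and set T = α_1 + ⋯ + α_{n−1}, S = (n−1)α_1 + (n−2)α_2 + ⋯ + 1·α_{n−1}, and D = mT + S. Then e_n ≤ (∏_{j=1}^{n−1} e_j^{m α_j / D}) · e_{n+m}^{S/D}. -/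
open Finset

theorem log_up (n m : ℕ) (L : ℕ → ℝ) (hn : 2 ≤ n)
    (h : ∀ k, 2 ≤ k → k + 1 ≤ n + m → 2 * L k ≤ L (k - 1) + L (k + 1)) (i : ℕ) (hi : i + 1 ≤ m) :
    L (n + 1) - L n ≤ L (n + i + 1) - L (n + i) ∧
      ((i : ℝ) + 1) * (L (n + 1) - L n) ≤ L (n + i + 1) - L n := by
  induction i with
  | zero => simp
  | succ i ih =>
    obtain ⟨h1, h2⟩ := ih (by omega)
    have h3 := h (n + i + 1) (by omega) (by omega)
    rw [show n + i + 1 - 1 = n + i by omega] at h3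
    rw [show n + (i + 1) = n + i + 1 by omega]
    push_cast
    constructor <;> linarith

theorem log_down (n m : ℕ) (L : ℕ → ℝ) (hm : 1 ≤ m)
    (h : ∀ k, 2 ≤ k → k + 1 ≤ n + m → 2 * L k ≤ L (k - 1) + L (k + 1)) (i : ℕ) (hi : i + 1 ≤ n) :
    L (n - i + 1) - L (n - i) ≤ L (n + 1) - L n ∧
      L n - L (n - i) ≤ (i : ℝ) * (L (n + 1) - L n) := by
  induction i with
  | zero => simp
  | succ i ih =>
    obtain ⟨h1, h2⟩ := ih (by omega)
    have h3 := h (n - i) (by omega) (by omega)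
    rw [show n - i - 1 = n - (i + 1) by omega] at h3
    rw [show n - (i + 1) + 1 = n - i by omega]
    push_cast
    constructor <;> linarith

/-- Weighted product estimate for a positive log-convex sequence
`e 1, …, e (n+m)`: with nonnegative weights `α 1, …, α (n-1)`, not all zero,
`T = ∑ α j`, `S = ∑ (n-j) α j`, `D = m T + S`, one has
`e n ≤ (∏ j, e j ^ (m α j / D)) * e (n+m) ^ (S / D)`. -/
theorem stmt_2 (n m : ℕ) (hn : 2 ≤ n) (hm : 1 ≤ m) (e : ℕ → ℝ) (α : ℕ → ℝ)
    (hpos : ∀ k, 1 ≤ k → k ≤ n + m → 0 < e k)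
    (hlc : ∀ k, 2 ≤ k → k + 1 ≤ n + m → e k ^ 2 ≤ e (k - 1) * e (k + 1))
    (hα : ∀ j ∈ Finset.Icc 1 (n - 1), 0 ≤ α j)
    (hα0 : ∃ j ∈ Finset.Icc 1 (n - 1), α j ≠ 0)
    (T S D : ℝ)
    (hT : T = ∑ j ∈ Finset.Icc 1 (n - 1), α j)
    (hS : S = ∑ j ∈ Finset.Icc 1 (n - 1), ((n - j : ℕ) : ℝ) * α j)
    (hD : D = (m : ℝ) * T + S) :
    e n ≤ (∏ j ∈ Finset.Icc 1 (n - 1), e j ^ ((m : ℝ) * α j / D)) *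
      e (n + m) ^ (S / D) := by
  have hL : ∀ k, 2 ≤ k → k + 1 ≤ n + m →
      2 * Real.log (e k) ≤ Real.log (e (k - 1)) + Real.log (e (k + 1)) := by
    intro k h1 h2
    have a := hpos k (by omega) (by omega)
    have b := hpos (k - 1) (by omega) (by omega)
    have c := hpos (k + 1) (by omega) (by omega)
    rw [← Real.log_mul b.ne' c.ne']
    have := Real.log_le_log (by positivity) (hlc k h1 h2)
    rwa [Real.log_pow] at this
  have hm0 : (0 : ℝ) < m := by exact_mod_cast hm
  have hT0 : 0 < T := by
    rw [hT]
    obtain ⟨j, hj, hj0⟩ := hα0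
    exact Finset.sum_pos' hα ⟨j, hj, lt_of_le_of_ne (hα j hj) (Ne.symm hj0)⟩
  have hS0 : 0 ≤ S := by
    rw [hS]
    exact Finset.sum_nonneg fun j hj => mul_nonneg (Nat.cast_nonneg _) (hα j hj)
  have hD0 : 0 < D := by rw [hD]; positivity
  have hposj : ∀ j ∈ Finset.Icc 1 (n - 1), 0 < e j := by
    intro j hj
    rw [Finset.mem_Icc] at hj
    exact hpos j hj.1 (by omega)
  have hen := hpos n (by omega) (by omega)
  have henm := hpos (n + m) (by omega) (by omega)
  have hP : 0 < ∏ j ∈ Finset.Icc 1 (n - 1), e j ^ ((m : ℝ) * α j / D) :=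
    Finset.prod_pos fun j hj => Real.rpow_pos_of_pos (hposj j hj) _
  have hQ : 0 < e (n + m) ^ (S / D) := Real.rpow_pos_of_pos henm _
  rw [← Real.log_le_log_iff hen (mul_pos hP hQ), Real.log_mul hP.ne' hQ.ne',
    Real.log_prod fun j hj => (Real.rpow_pos_of_pos (hposj j hj) _).ne', Real.log_rpow henm]
  have hup : (m : ℝ) * (Real.log (e (n + 1)) - Real.log (e n)) ≤
      Real.log (e (n + m)) - Real.log (e n) := by
    obtain ⟨i, rfl⟩ : ∃ i, m = i + 1 := ⟨m - 1, by omega⟩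
    have := (log_up n (i + 1) (fun k => Real.log (e k)) hn hL i le_rfl).2
    push_cast
    exact this
  have hj : ∀ j ∈ Finset.Icc 1 (n - 1), (m : ℝ) * α j * Real.log (e n) ≤
      (m : ℝ) * α j * Real.log (e j) +
        ((n - j : ℕ) : ℝ) * α j * (Real.log (e (n + m)) - Real.log (e n)) := by
    intro j hj
    have ha := hα j hj
    rw [Finset.mem_Icc] at hj
    have h1 := (log_down n m (fun k => Real.log (e k)) hm hL (n - j) (by omega)).2
    simp only [show n - (n - j) = j by omega] at h1
    have h2 := mul_le_mul_of_nonneg_left h1 (mul_nonneg hm0.le ha)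
    have h3 := mul_le_mul_of_nonneg_left hup (mul_nonneg (Nat.cast_nonneg (α := ℝ) (n - j)) ha)
    linarith
  have hsum := Finset.sum_le_sum hj
  rw [Finset.sum_add_distrib, ← Finset.sum_mul, ← Finset.sum_mul, ← Finset.mul_sum, ← hT,
    ← hS] at hsum
  have hfin : ∑ j ∈ Finset.Icc 1 (n - 1), Real.log (e j ^ ((m : ℝ) * α j / D)) =
      (∑ j ∈ Finset.Icc 1 (n - 1), (m : ℝ) * α j * Real.log (e j)) / D := by
    rw [Finset.sum_div]
    refine Finset.sum_congr rfl fun j hj => ?_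
    rw [Real.log_rpow (hposj j hj)]
    ring
  rw [hfin, div_mul_eq_mul_div, ← add_div, le_div_iff₀ hD0, hD]
  linarith
end

section
/- Let n ≥ 2 and let (e_k)_{k≥1} be a sequence of positive real numbers which is log-convex, i.e. e_k^2 ≤ e_{k-1}·e_{k+1} for all k ≥ 2, and let γ > 0 be a real number such that e_k ≤ γ^k for all k ≥ 1. Then for all nonnegative real numbers β_1, …, β_{n−1} with β_1 + ⋯ + β_{n−1} = 1, one has e_n ≤ (e_1/γ)^{β_1} · (e_2/γ^2)^{β_2} · ⋯ · (e_{n−1}/γ^{n−1})^{β_{n−1}} · γ^n. -/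
open Finset

/-- A positive log-convex sequence bounded by `1` is nonincreasing. -/
lemma step_aux (a : ℕ → ℝ) (hpos : ∀ k, 1 ≤ k → 0 < a k)
    (hlc : ∀ k, 1 ≤ k → a (k + 1) ^ 2 ≤ a k * a (k + 2))
    (hb : ∀ k, 1 ≤ k → a k ≤ 1) (k : ℕ) (hk : 1 ≤ k) : a (k + 1) ≤ a k := by
  by_contra! hlt
  have h0 := hpos k hk
  obtain ⟨r, hr⟩ : ∃ r, r = a (k + 1) / a k := ⟨_, rfl⟩
  have hr1 : 1 < r := by rw [hr, one_lt_div h0]; exact hlt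
  have hratio : ∀ m, r * a (k + m) ≤ a (k + m + 1) := by
    intro m
    induction m with
    | zero => rw [hr]; simp [h0.ne']
    | succ m ih =>
      have hp := hpos (k + m) (by omega)
      have hp1 := hpos (k + m + 1) (by omega)
      have hl := hlc (k + m) (by omega)
      have : r * a (k + m + 1) ≤ a (k + m + 2) := by
        refine le_of_mul_le_mul_left ?_ hp
        nlinarith [mul_le_mul_of_nonneg_right ih hp1.le]
      exact this
  have hgeo : ∀ m, r ^ m * a k ≤ a (k + m) := by
    intro m
    induction m with
    | zero => simp
    | succ m ih =>
      calc r ^ (m + 1) * a k = r * (r ^ m * a k) := by ring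
        _ ≤ r * a (k + m) := by gcongr
        _ ≤ _ := hratio m
  obtain ⟨m, hm⟩ := pow_unbounded_of_one_lt (1 / a k) hr1
  rw [div_lt_iff₀ h0] at hm
  linarith [hgeo m, hb (k + m) (by omega)]

/-- Sharp estimate, sequence-level form: if `(e k)` is a positive log-convex
sequence with `e k ≤ γ ^ k` for all `k ≥ 1` (`γ > 0`), then for any
nonnegative weights `β 1, …, β (n-1)` summing to `1`,
`e n ≤ (∏ j, (e j / γ ^ j) ^ β j) * γ ^ n`. -/
theorem stmt_5 (n : ℕ) (hn : 2 ≤ n) (e : ℕ → ℝ) (γ : ℝ) (hγ : 0 < γ)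
    (hpos : ∀ k, 1 ≤ k → 0 < e k)
    (hlc : ∀ k, 2 ≤ k → e k ^ 2 ≤ e (k - 1) * e (k + 1))
    (hbound : ∀ k, 1 ≤ k → e k ≤ γ ^ k)
    (β : ℕ → ℝ)
    (hβ : ∀ j ∈ Finset.Icc 1 (n - 1), 0 ≤ β j)
    (hβsum : ∑ j ∈ Finset.Icc 1 (n - 1), β j = 1) :
    e n ≤ (∏ j ∈ Finset.Icc 1 (n - 1), (e j / γ ^ j) ^ β j) * γ ^ n := by
  have ha : ∀ k, 1 ≤ k → 0 < e k / γ ^ k := fun k hk => div_pos (hpos k hk) (by positivity)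
  have hstep := step_aux (fun k => e k / γ ^ k) ha
    (by
      intro k hk
      have h := hlc (k + 1) (by omega)
      simp only [Nat.add_sub_cancel] at h
      show (e (k + 1) / γ ^ (k + 1)) ^ 2 ≤ e k / γ ^ k * (e (k + 2) / γ ^ (k + 2))
      have e1 : (e (k + 1) / γ ^ (k + 1)) ^ 2 = e (k + 1) ^ 2 / (γ ^ (2 * k + 2)) := by
        rw [div_pow]; congr 1; ring
      have e2 : e k / γ ^ k * (e (k + 2) / γ ^ (k + 2)) = e k * e (k + 2) / (γ ^ (2 * k + 2)) := by
        rw [div_mul_div_comm]; congr 1; ring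
      rw [e1, e2]
      gcongr)
    (fun k hk => (div_le_one (by positivity)).2 (hbound k hk))
  have hanti : ∀ j, 1 ≤ j → ∀ m, j ≤ m → e m / γ ^ m ≤ e j / γ ^ j := by
    intro j hj m hm
    induction m, hm using Nat.le_induction with
    | base => exact le_rfl
    | succ m hm ih => exact (hstep m (by omega)).trans ih
  rw [← div_le_iff₀ (by positivity)]
  have hn0 := ha n (by omega)
  calc e n / γ ^ n = ∏ j ∈ Finset.Icc 1 (n - 1), (e n / γ ^ n) ^ β j := by
        rw [← Real.rpow_sum_of_pos hn0, hβsum, Real.rpow_one]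
    _ ≤ _ := by
        refine Finset.prod_le_prod (fun j _ => Real.rpow_nonneg hn0.le _) ?_
        intro j hj
        have hj' := Finset.mem_Icc.1 hj
        exact Real.rpow_le_rpow hn0.le (hanti j hj'.1 n (by omega)) (hβ j hj)
end
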